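/- arXiv:1212.1352 — 3 statements merged into one kernel-verified Lean document; each statement's English description precedes it below -/
import Mathlib

section
/- Fix λ ∈ (0,1], t ∈ [t0,T], h > 0, A ≥ 0 and reals ζ_1, …, ζ_m with |ζ_r| ≤ A. Suppose Assumption 2 holds, set ã(t,x) = a(t,x) − λ Σ_{r=1}^m ∇σ_r(t,x)σ_r(t,x), and define ψ : ℝ^d → ℝ^d by ψ(z) = z − λ h ã(t+λh, z) − λ √h Σ_{r=1}^m σ_r(t+λh, z) ζ_r. Then for all z, y ∈ ℝ^d: (z−y, ψ(z)−ψ(y)) ≥ (1 − λ[h c1 + mλ L2 h + m L1 A √h]) |z−y|². -/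
open scoped RealInnerProductSpace BigOperators

/-- If each term of a sum indexed by `Fin m` is bounded in norm by `K * ‖x‖`, then the inner product
of `x` with the sum is bounded by `m * K * ‖x‖ ^ 2`. -/
lemma abs_inner_sum_le_card_mul {E : Type*} [NormedAddCommGroup E] [InnerProductSpace ℝ E] {m : ℕ}
    {x : E} {v : Fin m → E} {K : ℝ} (hv : ∀ r, ‖v r‖ ≤ K * ‖x‖) :
    |⟪x, ∑ r, v r⟫| ≤ m * K * ‖x‖ ^ 2 := by
  have hsum : ‖∑ r, v r‖ ≤ m * (K * ‖x‖) := by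
    simpa using norm_sum_le_of_le Finset.univ (fun r _ => hv r)
  calc |⟪x, ∑ r, v r⟫| ≤ ‖x‖ * ‖∑ r, v r‖ := abs_real_inner_le_norm _ _
    _ ≤ ‖x‖ * (m * (K * ‖x‖)) := by gcongr
    _ = m * K * ‖x‖ ^ 2 := by ring

/-- inequality (lres3): under Assumption 2, the map
`ψ(z) = z − λh ã(t+λh, z) − λ√h Σ_r σ_r(t+λh, z) ζ_r` associated with the
fully implicit scheme satisfies the monotonicity estimate
`(z−y, ψ(z)−ψ(y)) ≥ (1 − λ[h c1 + mλ L2 h + m L1 A √h]) |z−y|²`. -/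
theorem fully_implicit_psi_monotone
    (d m : ℕ) (t0 T : ℝ) (ht : t0 < T)
    (a : ℝ → EuclideanSpace ℝ (Fin d) → EuclideanSpace ℝ (Fin d))
    (σ : Fin m → ℝ → EuclideanSpace ℝ (Fin d) → EuclideanSpace ℝ (Fin d))
    (Dσ : Fin m → ℝ → EuclideanSpace ℝ (Fin d) →
      (EuclideanSpace ℝ (Fin d) →L[ℝ] EuclideanSpace ℝ (Fin d)))
    (c1 c2 ϰ L1 L2 : ℝ) (hc1 : 0 ≤ c1) (hc2 : 0 ≤ c2) (hϰ : 1 ≤ ϰ)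
    (hL1 : 0 ≤ L1) (hL2 : 0 ≤ L2)
    -- Assumption 2 (ii)
    (hOneSided : ∀ (t : ℝ) (x y : EuclideanSpace ℝ (Fin d)),
      ⟪x - y, a t x - a t y⟫ ≤ c1 * ‖x - y‖^2)
    -- Assumption 2 (iii)
    (hPolyLip : ∀ (t : ℝ) (x y : EuclideanSpace ℝ (Fin d)),
      ‖a t x - a t y‖^2
        ≤ c2 * (1 + ‖x‖ ^ (2*ϰ - 2) + ‖y‖ ^ (2*ϰ - 2)) * ‖x - y‖^2)
    -- Assumption 2 (iv): Dσ is the spatial derivative of σ, bounded by L1,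
    -- and x ↦ ∇σ_r(t,x)σ_r(t,x) is L2-Lipschitz
    (hDσ : ∀ (r : Fin m) (t : ℝ) (x : EuclideanSpace ℝ (Fin d)),
      HasFDerivAt (σ r t) (Dσ r t x) x)
    (hDσbound : ∀ (r : Fin m) (t : ℝ) (x : EuclideanSpace ℝ (Fin d)),
      ‖Dσ r t x‖ ≤ L1)
    (hDσσLip : ∀ (r : Fin m) (t : ℝ) (x y : EuclideanSpace ℝ (Fin d)),
      ‖Dσ r t x (σ r t x) - Dσ r t y (σ r t y)‖ ≤ L2 * ‖x - y‖)
    (lam : ℝ) (hlam : lam ∈ Set.Ioc (0 : ℝ) 1)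
    (t : ℝ) (htmem : t ∈ Set.Icc t0 T)
    (h : ℝ) (hh : 0 < h) (A : ℝ) (hA : 0 ≤ A)
    (ζ : Fin m → ℝ) (hζ : ∀ r, |ζ r| ≤ A)
    -- the modified drift ã and the map ψ
    (atil : ℝ → EuclideanSpace ℝ (Fin d) → EuclideanSpace ℝ (Fin d))
    (hatil : ∀ (s : ℝ) (x : EuclideanSpace ℝ (Fin d)),
      atil s x = a s x - lam • ∑ r, Dσ r s x (σ r s x))
    (ψ : EuclideanSpace ℝ (Fin d) → EuclideanSpace ℝ (Fin d))
    (hψ : ∀ z, ψ z = z - (lam * h) • atil (t + lam*h) z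
        - (lam * Real.sqrt h) • ∑ r, ζ r • σ r (t + lam*h) z) :
    ∀ z y : EuclideanSpace ℝ (Fin d),
      ⟪z - y, ψ z - ψ y⟫
        ≥ (1 - lam * (h*c1 + m*lam*L2*h + m*L1*A*Real.sqrt h)) * ‖z - y‖^2 := by
  intro z y
  have hσLip : ∀ r, ‖σ r (t + lam*h) z - σ r (t + lam*h) y‖ ≤ L1 * ‖z - y‖ := fun r =>
    convex_univ.norm_image_sub_le_of_norm_hasFDerivWithin_le
      (fun x _ => (hDσ r (t + lam*h) x).hasFDerivWithinAt)
      (fun x _ => hDσbound r (t + lam*h) x) (Set.mem_univ y) (Set.mem_univ z)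
  have hnoise := abs_inner_sum_le_card_mul (x := z - y) (K := L1 * A)
    (v := fun r => ζ r • (σ r (t + lam*h) z - σ r (t + lam*h) y)) (fun r => by
      rw [norm_smul, Real.norm_eq_abs]
      calc |ζ r| * ‖σ r (t + lam*h) z - σ r (t + lam*h) y‖ ≤ A * (L1 * ‖z - y‖) := by
            gcongr
            exacts [hζ r, hσLip r]
        _ = L1 * A * ‖z - y‖ := by ring)
  have hcorr := abs_inner_sum_le_card_mul (fun r => hDσσLip r (t + lam*h) z y)
  have hdrift := hOneSided (t + lam*h) z y
  have hdecomp : ψ z - ψ y = (z - y) - (lam * h) • (a (t + lam*h) z - a (t + lam*h) y)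
      + (lam * h * lam) • ∑ r, (Dσ r (t + lam*h) z (σ r (t + lam*h) z)
        - Dσ r (t + lam*h) y (σ r (t + lam*h) y))
      - (lam * Real.sqrt h) • ∑ r, ζ r • (σ r (t + lam*h) z - σ r (t + lam*h) y) := by
    simp only [hψ, hatil, smul_sub, Finset.sum_sub_distrib, smul_smul]
    abel
  rw [hdecomp, inner_sub_right, inner_add_right, inner_sub_right, real_inner_smul_right,
    real_inner_smul_right, real_inner_smul_right, real_inner_self_eq_norm_sq]
  have hlam0 : 0 ≤ lam := hlam.1.le
  have hdrift' := mul_le_mul_of_nonneg_left hdrift (show 0 ≤ lam * h by positivity)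
  have hcorr' := mul_le_mul_of_nonneg_left (neg_le_of_abs_le hcorr)
    (show 0 ≤ lam * h * lam by positivity)
  have hnoise' := mul_le_mul_of_nonneg_left (le_of_abs_le hnoise)
    (show 0 ≤ lam * Real.sqrt h by positivity)
  linarith
end

section
/- Let λ ∈ (0,1], l ≥ 1, and suppose Assumption 2 holds with the σ_r(t,·) continuous in both variables and a continuous. Fix ε ∈ (0,1) and let h ∈ (0,1) satisfy λ[h c1 + mλ L2 h + m L1 √(2 l h |ln h|)] ≤ 1 − ε. Then for every t ∈ [t0,T], every x ∈ ℝ^d and all reals ζ_1, …, ζ_m with |ζ_r| ≤ √(2 l |ln h|), there exists a unique X̄ ∈ ℝ^d satisfying the implicit one-step equation X̄ = x + ã(t+λh, U) h + Σ_{r=1}^m σ_r(t+λh, U) ζ_r √h, where U = (1−λ)x + λ X̄ and ã(t,x) = a(t,x) − λ Σ_{r=1}^m ∇σ_r(t,x)σ_r(t,x). -/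
open scoped RealInnerProductSpace BigOperators

/-- A variational characterization of the metric projection onto a closed convex set. -/
theorem exists_mem_forall_inner_sub_le_zero {E : Type*} [NormedAddCommGroup E]
    [InnerProductSpace ℝ E] [CompleteSpace E] {K : Set E} (hne : K.Nonempty)
    (hclosed : IsClosed K) (hconv : Convex ℝ K) (u : E) :
    ∃ v ∈ K, ∀ w ∈ K, ⟪u - v, w - v⟫ ≤ 0 := by
  obtain ⟨v, hv, hmin⟩ := exists_norm_eq_iInf_of_complete_convex hne hclosed.isComplete hconv u
  exact ⟨v, hv, (norm_eq_iInf_iff_real_inner_le_zero hconv hv).1 hmin⟩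

/-- A strongly monotone, Lipschitz map on a closed convex set solves the variational
inequality on that set. -/
theorem exists_variational_inequality_of_strongly_monotone {E : Type*} [NormedAddCommGroup E]
    [InnerProductSpace ℝ E] [CompleteSpace E] {K : Set E} (hne : K.Nonempty)
    (hclosed : IsClosed K) (hconv : Convex ℝ K) (G : E → E) {ε L : ℝ} (hε : 0 < ε)
    (hmono : ∀ u v, ε * ‖u - v‖ ^ 2 ≤ ⟪u - v, G u - G v⟫)
    (hlip : ∀ u ∈ K, ∀ v ∈ K, ‖G u - G v‖ ≤ L * ‖u - v‖) :
    ∃ u ∈ K, ∀ w ∈ K, 0 ≤ ⟪G u, w - u⟫ := by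
  choose P hPK hP using exists_mem_forall_inner_sub_le_zero hne hclosed hconv
  have hPne : ∀ u v, ‖P u - P v‖ ≤ ‖u - v‖ := by
    intro u v
    have h1 := hP u (P v) (hPK v)
    have h2 := hP v (P u) (hPK u)
    have h3 : ‖P u - P v‖ ^ 2 ≤ ⟪u - v, P u - P v⟫ := by
      rw [← real_inner_self_eq_norm_sq]
      simp only [inner_sub_left, inner_sub_right] at h1 h2 ⊢
      linarith
    have h4 := real_inner_le_norm (u - v) (P u - P v)
    by_contra! hlt
    nlinarith [norm_nonneg (u - v)]
  have hPfix : ∀ u ∈ K, P u = u := by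
    intro u hu
    have h1 := hP u u hu
    rw [real_inner_self_eq_norm_sq] at h1
    have h2 : ‖u - P u‖ = 0 := by nlinarith [norm_nonneg (u - P u)]
    exact (sub_eq_zero.1 (norm_eq_zero.1 h2)).symm
  set M : ℝ := max L (max 1 ε)
  have hM1 : 1 ≤ M := (le_max_left _ _).trans (le_max_right _ _)
  have hMε : ε ≤ M := (le_max_right _ _).trans (le_max_right _ _)
  have hML : L ≤ M := le_max_left _ _
  have hM0 : 0 < M ^ 2 := by positivity
  set τ : ℝ := ε / M ^ 2 with hτ
  have hτ0 : 0 < τ := by positivity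
  set q : ℝ := 1 - ε ^ 2 / M ^ 2 with hq
  have hq0 : 0 ≤ q := by
    rw [hq, sub_nonneg, div_le_one hM0]
    gcongr
  have hq1 : q < 1 := by
    have : 0 < ε ^ 2 / M ^ 2 := by positivity
    linarith
  have hstep : ∀ u ∈ K, ∀ v ∈ K, ‖(u - τ • G u) - (v - τ • G v)‖ ≤ √q * ‖u - v‖ := by
    intro u hu v hv
    have h1 : ‖G u - G v‖ ^ 2 ≤ M ^ 2 * ‖u - v‖ ^ 2 := by
      rw [← mul_pow]
      gcongr
      exact (hlip u hu v hv).trans (by gcongr)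
    have h2 := hmono u v
    have h3 : (u - τ • G u) - (v - τ • G v) = (u - v) - τ • (G u - G v) := by
      rw [smul_sub]; abel
    have h4 : q = 1 - 2 * τ * ε + τ ^ 2 * M ^ 2 := by
      rw [hq, hτ]; field_simp; ring
    refine (sq_le_sq₀ (norm_nonneg _) (by positivity)).1 ?_
    rw [mul_pow, Real.sq_sqrt hq0, h3, norm_sub_sq_real, inner_smul_right, norm_smul, mul_pow,
      Real.norm_eq_abs, sq_abs, h4]
    nlinarith [mul_le_mul_of_nonneg_left h1 (sq_nonneg τ),
      mul_le_mul_of_nonneg_left h2 hτ0.le]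
  have hcontr : ContractingWith (√q).toNNReal fun u => P (P u - τ • G (P u)) := by
    refine ⟨?_, LipschitzWith.of_dist_le_mul fun u v => ?_⟩
    · rw [Real.toNNReal_lt_one]
      exact (Real.sqrt_lt' one_pos).2 (by simpa using hq1)
    · rw [dist_eq_norm, dist_eq_norm, Real.coe_toNNReal _ (Real.sqrt_nonneg q)]
      refine (hPne _ _).trans ((hstep _ (hPK u) _ (hPK v)).trans ?_)
      gcongr
      exact hPne u v
  obtain ⟨u, hu⟩ : ∃ u, P (P u - τ • G (P u)) = u := ⟨_, hcontr.fixedPoint_isFixedPt⟩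
  have huK : u ∈ K := hu ▸ hPK _
  rw [hPfix u huK] at hu
  refine ⟨u, huK, fun w hw => ?_⟩
  have h1 := hP (u - τ • G u) w hw
  rw [hu, sub_sub_cancel_left, inner_neg_left, real_inner_smul_left] at h1
  exact (mul_nonneg_iff_of_pos_left hτ0).1 (by linarith)

/-- A strongly monotone map of a real Hilbert space which is Lipschitz on bounded sets is
bijective. -/
theorem bijective_of_strongly_monotone {E : Type*} [NormedAddCommGroup E]
    [InnerProductSpace ℝ E] [CompleteSpace E] (G : E → E) {ε : ℝ} (hε : 0 < ε)
    (hmono : ∀ u v, ε * ‖u - v‖ ^ 2 ≤ ⟪u - v, G u - G v⟫)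
    (hlip : ∀ R : ℝ, ∃ L : ℝ, ∀ u v, ‖u‖ ≤ R → ‖v‖ ≤ R → ‖G u - G v‖ ≤ L * ‖u - v‖) :
    Function.Bijective G := by
  refine ⟨fun u v huv => ?_, fun y => ?_⟩
  · have h1 := hmono u v
    rw [huv, sub_self, inner_zero_right] at h1
    have h2 : ‖u - v‖ ^ 2 = 0 :=
      le_antisymm (nonpos_of_mul_nonpos_right h1 hε) (sq_nonneg _)
    exact sub_eq_zero.1 (norm_eq_zero.1 (pow_eq_zero_iff two_ne_zero |>.1 h2))
  set R : ℝ := ‖y - G 0‖ / ε + 1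
  have hR0 : 0 ≤ R := by positivity
  obtain ⟨L, hL⟩ := hlip R
  obtain ⟨u, huK, hu⟩ := exists_variational_inequality_of_strongly_monotone
    (K := Metric.closedBall (0 : E) R) ⟨0, by simpa using hR0⟩ Metric.isClosed_closedBall
    (convex_closedBall _ _) (fun u => G u - y) (L := L) hε (fun u v => by simpa using hmono u v)
    (fun u hu v hv => by
      simpa using hL u v (mem_closedBall_zero_iff.1 hu) (mem_closedBall_zero_iff.1 hv))
  have hbound : ‖u‖ ≤ ‖y - G 0‖ / ε := by
    have h0 := hu 0 (by simpa using hR0)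
    have h1 := hmono u 0
    have h2 := real_inner_le_norm u (y - G 0)
    rw [zero_sub, inner_neg_right, real_inner_comm] at h0
    rw [sub_zero] at h1
    have h3 : ε * ‖u‖ ^ 2 ≤ ‖u‖ * ‖y - G 0‖ := by
      simp only [inner_sub_right] at h0 h1 h2
      linarith
    rw [le_div_iff₀ hε]
    by_contra! hlt
    have hpos : 0 < ‖u‖ := by
      by_contra! hle
      have : ‖u‖ = 0 := le_antisymm hle (norm_nonneg _)
      rw [this] at hlt
      linarith [norm_nonneg (y - G 0)]
    nlinarith
  set g := G u - y
  have hw := hu (u - (‖g‖ + 1)⁻¹ • g) <| by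
    rw [mem_closedBall_zero_iff]
    refine (norm_sub_le _ _).trans (add_le_add hbound ?_)
    rw [norm_smul, norm_inv, Real.norm_of_nonneg (by positivity), inv_mul_le_one₀ (by positivity)]
    linarith
  rw [sub_sub_cancel_left, inner_neg_right, real_inner_smul_right,
    real_inner_self_eq_norm_sq] at hw
  have h1 : 0 < (‖g‖ + 1)⁻¹ := by positivity
  have h2 : ‖g‖ ^ 2 ≤ 0 := nonpos_of_mul_nonpos_right (by linarith) h1
  have h3 : ‖g‖ = 0 := by nlinarith [norm_nonneg g]
  exact ⟨u, sub_eq_zero.1 (norm_eq_zero.1 h3)⟩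

/-- part of Lemma 3: unique solvability of the implicit one-step
equation of the fully implicit scheme for step sizes satisfying
`λ[h c1 + mλ L2 h + m L1 √(2lh|ln h|)] ≤ 1 − ε`. -/
theorem fully_implicit_one_step_unique_solvability
    (d m : ℕ) (t0 T : ℝ) (ht : t0 < T)
    (a : ℝ → EuclideanSpace ℝ (Fin d) → EuclideanSpace ℝ (Fin d))
    (σ : Fin m → ℝ → EuclideanSpace ℝ (Fin d) → EuclideanSpace ℝ (Fin d))
    (Dσ : Fin m → ℝ → EuclideanSpace ℝ (Fin d) →
      (EuclideanSpace ℝ (Fin d) →L[ℝ] EuclideanSpace ℝ (Fin d)))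
    (c1 c2 ϰ L1 L2 : ℝ) (hc1 : 0 ≤ c1) (hc2 : 0 ≤ c2) (hϰ : 1 ≤ ϰ)
    (hL1 : 0 ≤ L1) (hL2 : 0 ≤ L2)
    -- Assumption 2 (ii)
    (hOneSided : ∀ (t : ℝ) (x y : EuclideanSpace ℝ (Fin d)),
      ⟪x - y, a t x - a t y⟫ ≤ c1 * ‖x - y‖^2)
    -- Assumption 2 (iii)
    (hPolyLip : ∀ (t : ℝ) (x y : EuclideanSpace ℝ (Fin d)),
      ‖a t x - a t y‖^2
        ≤ c2 * (1 + ‖x‖ ^ (2*ϰ - 2) + ‖y‖ ^ (2*ϰ - 2)) * ‖x - y‖^2)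
    -- Assumption 2 (iv)
    (hDσ : ∀ (r : Fin m) (t : ℝ) (x : EuclideanSpace ℝ (Fin d)),
      HasFDerivAt (σ r t) (Dσ r t x) x)
    (hDσbound : ∀ (r : Fin m) (t : ℝ) (x : EuclideanSpace ℝ (Fin d)),
      ‖Dσ r t x‖ ≤ L1)
    (hDσσLip : ∀ (r : Fin m) (t : ℝ) (x y : EuclideanSpace ℝ (Fin d)),
      ‖Dσ r t x (σ r t x) - Dσ r t y (σ r t y)‖ ≤ L2 * ‖x - y‖)
    -- continuity of the coefficients
    (hacont : Continuous (Function.uncurry a))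
    (hσcont : ∀ r, Continuous (Function.uncurry (σ r)))
    -- the modified drift ã
    (atil : ℝ → EuclideanSpace ℝ (Fin d) → EuclideanSpace ℝ (Fin d))
    (lam : ℝ) (hlam : lam ∈ Set.Ioc (0 : ℝ) 1) (l : ℝ) (hl : 1 ≤ l)
    (hatil : ∀ (s : ℝ) (x : EuclideanSpace ℝ (Fin d)),
      atil s x = a s x - lam • ∑ r, Dσ r s x (σ r s x))
    (ε : ℝ) (hε : ε ∈ Set.Ioo (0 : ℝ) 1)
    (h : ℝ) (hh : h ∈ Set.Ioo (0 : ℝ) 1)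
    (hstep : lam * (h*c1 + m*lam*L2*h
        + m*L1*Real.sqrt (2*l*h*|Real.log h|)) ≤ 1 - ε) :
    ∀ t ∈ Set.Icc t0 T, ∀ x : EuclideanSpace ℝ (Fin d),
      ∀ ζ : Fin m → ℝ, (∀ r, |ζ r| ≤ Real.sqrt (2*l*|Real.log h|)) →
        ∃! Xb : EuclideanSpace ℝ (Fin d),
          Xb = x + h • atil (t + lam*h) ((1 - lam) • x + lam • Xb)
            + Real.sqrt h • ∑ r, ζ r • σ r (t + lam*h) ((1 - lam) • x + lam • Xb) := by
  intro t _ x ζ hζ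
  obtain ⟨hlam0, -⟩ := hlam
  obtain ⟨hh0, -⟩ := hh
  set s := t + lam * h
  set B := √(2 * l * |Real.log h|) with hB
  have hB0 : 0 ≤ B := Real.sqrt_nonneg _
  set F : EuclideanSpace ℝ (Fin d) → EuclideanSpace ℝ (Fin d) := fun u =>
    h • atil s u + √h • ∑ r, ζ r • σ r s u with hF
  have hσLip : ∀ r u v, ‖σ r s u - σ r s v‖ ≤ L1 * ‖u - v‖ := fun r u v =>
    convex_univ.norm_image_sub_le_of_norm_hasFDerivWithin_le
      (fun z _ => (hDσ r s z).hasFDerivWithinAt) (fun z _ => hDσbound r s z)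
      (Set.mem_univ v) (Set.mem_univ u)
  have hdrift : ∀ u v, ‖∑ r, (Dσ r s u (σ r s u) - Dσ r s v (σ r s v))‖
      ≤ m * L2 * ‖u - v‖ := fun u v =>
    (norm_sum_le_of_le _ fun r _ => hDσσLip r s u v).trans (by simp [mul_assoc])
  have hnoise : ∀ u v, ‖∑ r, ζ r • (σ r s u - σ r s v)‖ ≤ m * (B * L1) * ‖u - v‖ := by
    intro u v
    refine (norm_sum_le_of_le (f := fun r => ζ r • (σ r s u - σ r s v)) _
      (n := fun _ => B * (L1 * ‖u - v‖)) fun r _ => ?_).trans (by simp [mul_assoc])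
    rw [norm_smul]
    exact mul_le_mul (hζ r) (hσLip r u v) (norm_nonneg _) hB0
  have hFsub : ∀ u v, F u - F v = h • (a s u - a s v)
      - (h * lam) • ∑ r, (Dσ r s u (σ r s u) - Dσ r s v (σ r s v))
      + √h • ∑ r, ζ r • (σ r s u - σ r s v) := by
    intro u v
    simp only [hF, hatil, smul_sub, Finset.sum_sub_distrib, mul_smul]
    abel
  have hFmono : ∀ u v, lam * ⟪u - v, F u - F v⟫ ≤ (1 - ε) * ‖u - v‖ ^ 2 := by
    intro u v
    have h1 := hOneSided s u v
    have h2 := (abs_real_inner_le_norm (u - v)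
      (∑ r, (Dσ r s u (σ r s u) - Dσ r s v (σ r s v)))).trans
        (mul_le_mul_of_nonneg_left (hdrift u v) (norm_nonneg _))
    have h3 := (real_inner_le_norm (u - v) (∑ r, ζ r • (σ r s u - σ r s v))).trans
      (mul_le_mul_of_nonneg_left (hnoise u v) (norm_nonneg _))
    have hsqrt : √(2 * l * h * |Real.log h|) = √h * B := by
      rw [hB, ← Real.sqrt_mul hh0.le]
      ring_nf
    rw [hsqrt] at hstep
    refine le_trans ?_ (mul_le_mul_of_nonneg_right hstep (sq_nonneg ‖u - v‖))
    rw [mul_assoc]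
    refine mul_le_mul_of_nonneg_left ?_ hlam0.le
    rw [hFsub, inner_add_right, inner_sub_right, real_inner_smul_right, real_inner_smul_right,
      real_inner_smul_right]
    have e1 := mul_le_mul_of_nonneg_left h1 hh0.le
    have e2 := mul_le_mul_of_nonneg_left ((neg_le_abs _).trans h2) (mul_pos hh0 hlam0).le
    have e3 := mul_le_mul_of_nonneg_left h3 (Real.sqrt_nonneg h)
    linarith
  have haLip : ∀ R : ℝ, ∃ L : ℝ, ∀ u v, ‖u‖ ≤ R → ‖v‖ ≤ R →
      ‖a s u - a s v‖ ≤ L * ‖u - v‖ := by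
    intro R
    refine ⟨√(c2 * (1 + R ^ (2 * ϰ - 2) + R ^ (2 * ϰ - 2))), fun u v hu hv => ?_⟩
    have hR : 0 ≤ R := (norm_nonneg u).trans hu
    refine (sq_le_sq₀ (norm_nonneg _) (by positivity)).1 ?_
    rw [mul_pow, Real.sq_sqrt (by positivity)]
    have hexp : 0 ≤ 2 * ϰ - 2 := by linarith
    refine (hPolyLip s u v).trans ?_
    gcongr
  have hbij : Function.Bijective fun u => u - lam • F u := by
    refine bijective_of_strongly_monotone _ hε.1 (fun u v => ?_) fun R => ?_
    · have h1 := hFmono u v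
      have h2 : u - lam • F u - (v - lam • F v) = (u - v) - lam • (F u - F v) := by
        rw [smul_sub]; abel
      rw [h2, inner_sub_right, real_inner_smul_right, real_inner_self_eq_norm_sq]
      linarith
    · obtain ⟨L, hL⟩ := haLip R
      refine ⟨1 + lam * (h * L + h * lam * (m * L2) + √h * (m * (B * L1))),
        fun u v hu hv => ?_⟩
      have h2 : u - lam • F u - (v - lam • F v) = (u - v) - lam • (F u - F v) := by
        rw [smul_sub]; abel
      have h3 : ‖F u - F v‖
          ≤ h * (L * ‖u - v‖) + h * lam * (m * L2 * ‖u - v‖) + √h * (m * (B * L1) * ‖u - v‖) := by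
        rw [hFsub]
        refine (norm_add_le _ _).trans (add_le_add ((norm_sub_le _ _).trans (add_le_add ?_ ?_)) ?_)
        · rw [norm_smul, Real.norm_of_nonneg hh0.le]
          exact mul_le_mul_of_nonneg_left (hL u v hu hv) hh0.le
        · rw [norm_smul, Real.norm_of_nonneg (mul_pos hh0 hlam0).le]
          exact mul_le_mul_of_nonneg_left (hdrift u v) (mul_pos hh0 hlam0).le
        · rw [norm_smul, Real.norm_of_nonneg (Real.sqrt_nonneg h)]
          exact mul_le_mul_of_nonneg_left (hnoise u v) (Real.sqrt_nonneg h)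
      rw [h2]
      refine (norm_sub_le _ _).trans ?_
      rw [norm_smul, Real.norm_of_nonneg hlam0.le]
      linarith [mul_le_mul_of_nonneg_left h3 hlam0.le]
  have key : ∀ X, (X = x + h • atil s ((1 - lam) • x + lam • X)
      + √h • ∑ r, ζ r • σ r s ((1 - lam) • x + lam • X)) ↔
      ((1 - lam) • x + lam • X) - lam • F ((1 - lam) • x + lam • X) = x := by
    intro X
    rw [add_assoc, ← (smul_right_injective _ hlam0.ne').eq_iff]
    change lam • X = lam • (x + F ((1 - lam) • x + lam • X)) ↔ _
    generalize F ((1 - lam) • x + lam • X) = y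
    rw [← sub_eq_zero, ← sub_eq_zero (b := x)]
    refine Eq.congr_left ?_
    module
  obtain ⟨u, hu, huniq⟩ := hbij.existsUnique x
  have hback : (1 - lam) • x + lam • (lam⁻¹ • (u - (1 - lam) • x)) = u := by
    rw [smul_inv_smul₀ hlam0.ne', add_sub_cancel]
  refine ⟨lam⁻¹ • (u - (1 - lam) • x), (key _).2 (by rw [hback]; exact hu), fun X hX => ?_⟩
  rw [← huniq _ ((key X).1 hX), add_sub_cancel_left, inv_smul_smul₀ hlam0.ne']
end

section
/- Let p ≥ 1 and q > 0 be reals with p > 1/(2q), let K > 0, and let (Y_N)_{N≥1} be nonnegative real random variables on a probability space satisfying E[Y_N^{2p}] ≤ K N^{−2pq} for all N ≥ 1. Then for every ε with 1/(2p) < ε < q there exists an almost surely finite nonnegative random variable C(ω) such that, almost surely, Y_N ≤ C(ω) N^{−(q−ε)} for all N ≥ 1; in particular, with step h = (T−t0)/N, any family of numerical errors whose 2p-th moments are bounded by K h^{2pq} converges almost surely with order q − ε. -/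
open MeasureTheory
open scoped ENNReal

/-- If the `r`-th moments of a sequence of nonnegative random variables are summable, then the
sequence is almost surely dominated by a single nonnegative random variable. -/
theorem exists_measurable_ae_bound_of_tsum_lintegral_rpow_ne_top
    {Ω : Type*} [MeasurableSpace Ω] {μ : Measure Ω} {r : ℝ} (hr : 0 < r) {X : ℕ → Ω → ℝ}
    (hX : ∀ n, Measurable (X n)) (hX0 : ∀ n ω, 0 ≤ X n ω)
    (hsum : ∑' n, ∫⁻ ω, ENNReal.ofReal (X n ω ^ r) ∂μ ≠ ∞) :
    ∃ C : Ω → ℝ, Measurable C ∧ (∀ ω, 0 ≤ C ω) ∧ ∀ᵐ ω ∂μ, ∀ n, X n ω ≤ C ω := by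
  have hmeas (n : ℕ) : Measurable fun ω ↦ ENNReal.ofReal (X n ω ^ r) :=
    ((hX n).pow_const r).ennreal_ofReal
  have hS : Measurable fun ω ↦ ∑' n, ENNReal.ofReal (X n ω ^ r) := .tsum hmeas
  refine ⟨fun ω ↦ (∑' n, ENNReal.ofReal (X n ω ^ r)).toReal ^ r⁻¹,
    hS.ennreal_toReal.pow_const _, fun ω ↦ by positivity, ?_⟩
  rw [← lintegral_tsum fun n ↦ (hmeas n).aemeasurable] at hsum
  filter_upwards [ae_lt_top hS hsum] with ω hω n
  rw [Real.le_rpow_inv_iff_of_pos (hX0 n ω) ENNReal.toReal_nonneg hr]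
  exact (ENNReal.ofReal_le_iff_le_toReal hω.ne).1 (ENNReal.le_tsum n)

/-- the Borel–Cantelli mechanism behind the almost sure
convergence corollary. If `E[Y_N^{2p}] ≤ K N^{−2pq}` for all `N ≥ 1` with
`p > 1/(2q)`, then for every `ε` with `1/(2p) < ε < q` there is an almost
surely finite nonnegative random variable `C` such that, almost surely,
`Y_N ≤ C N^{−(q−ε)}` for all `N ≥ 1`. -/
theorem borel_cantelli_as_convergence_order
    {Ω : Type*} [MeasurableSpace Ω] (P : Measure Ω) [IsProbabilityMeasure P]
    (p q K : ℝ) (hp : 1 ≤ p) (hq : 0 < q) (hpq : 1/(2*q) < p) (hK : 0 < K)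
    (Y : ℕ → Ω → ℝ)
    (hYmeas : ∀ N, Measurable (Y N))
    (hYnonneg : ∀ N ω, 0 ≤ Y N ω)
    (hmom : ∀ N : ℕ, 1 ≤ N →
      ∫⁻ ω, ENNReal.ofReal ((Y N ω) ^ (2*p)) ∂P
        ≤ ENNReal.ofReal (K * (N : ℝ) ^ (-(2*p*q)))) :
    ∀ ε : ℝ, 1/(2*p) < ε → ε < q →
      ∃ C : Ω → ℝ, Measurable C ∧ (∀ ω, 0 ≤ C ω) ∧
        ∀ᵐ ω ∂P, ∀ N : ℕ, 1 ≤ N →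
          Y N ω ≤ C ω * (N : ℝ) ^ (-(q - ε)) := by
  intro ε hε _
  have hp0 : 0 < 2 * p := by linarith
  have hεp : 1 < 2 * p * ε := by rwa [div_lt_iff₀' hp0] at hε
  have hpos (n : ℕ) : (0 : ℝ) < (n + 1 : ℕ) := by positivity
  have hscaled (n : ℕ) :
      ∫⁻ ω, ENNReal.ofReal ((((n + 1 : ℕ) : ℝ) ^ (q - ε) * Y (n + 1) ω) ^ (2 * p)) ∂P
        ≤ ENNReal.ofReal (K * ((n + 1 : ℕ) : ℝ) ^ (-(2 * p * ε))) := by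
    have hmul (ω : Ω) :
        ENNReal.ofReal ((((n + 1 : ℕ) : ℝ) ^ (q - ε) * Y (n + 1) ω) ^ (2 * p)) =
          ENNReal.ofReal (((n + 1 : ℕ) : ℝ) ^ ((q - ε) * (2 * p))) *
            ENNReal.ofReal (Y (n + 1) ω ^ (2 * p)) := by
      rw [Real.mul_rpow (by positivity) (hYnonneg _ ω), ← Real.rpow_mul (hpos n).le,
        ENNReal.ofReal_mul (by positivity)]
    simp_rw [hmul]
    rw [lintegral_const_mul _ ((hYmeas _).pow_const _).ennreal_ofReal]
    refine (mul_le_mul_right (hmom (n + 1) n.succ_pos) _).trans_eq ?_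
    rw [← ENNReal.ofReal_mul (by positivity), mul_left_comm, ← Real.rpow_add (hpos n)]
    ring_nf
  have hsummable : Summable fun n : ℕ ↦ K * ((n + 1 : ℕ) : ℝ) ^ (-(2 * p * ε)) :=
    ((summable_nat_add_iff 1).2 (Real.summable_nat_rpow.2 (by linarith))).mul_left K
  obtain ⟨C, hC, hC0, hbound⟩ := exists_measurable_ae_bound_of_tsum_lintegral_rpow_ne_top hp0
    (fun n ↦ (hYmeas (n + 1)).const_mul (((n + 1 : ℕ) : ℝ) ^ (q - ε)))
    (fun n ω ↦ mul_nonneg (by positivity) (hYnonneg _ ω))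
    (ne_top_of_le_ne_top hsummable.tsum_ofReal_ne_top (ENNReal.tsum_le_tsum hscaled))
  refine ⟨C, hC, hC0, ?_⟩
  filter_upwards [hbound] with ω hω N hN
  obtain ⟨n, rfl⟩ := Nat.exists_eq_add_of_le' hN
  rw [Real.rpow_neg (hpos n).le, ← div_eq_mul_inv,
    le_div_iff₀' (Real.rpow_pos_of_pos (hpos n) _)]
  exact hω n
end
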